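/- arXiv:2509.24442 — 2 statements merged into one kernel-verified Lean document; each statement's English description precedes it below -/
import Mathlib

section
/- For every x ∈ ℝⁿ with x_i ≠ 0 for all i ∈ {1,…,n}, setting v = x^{b/2}/|x|_b^{1/2} ∈ ℝⁿ, one has |v| = 1 and D_p(DΦ₀(x))·D²Φ₀(x)·D_p(DΦ₀(x)) = |x|_b^{−(a+1)(p+1)}·( b(a+1)·(v ⊗ v) − (b−1)·I_n ), where v ⊗ v denotes the matrix (v_i v_j)_{i,j} and I_n the n×n identity matrix. -/
noncomputable section

/-- Euclidean space ℝⁿ. -/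
abbrev En (n : ℕ) := EuclideanSpace ℝ (Fin n)

/-- The gradient vector `Dψ(x)` of coordinatewise partial derivatives. -/
noncomputable def gradVec {n : ℕ} (ψ : En n → ℝ) (x : En n) : Fin n → ℝ :=
  fun i => fderiv ℝ ψ x (EuclideanSpace.single i 1)

/-- The Hessian matrix `D²ψ(x)` of second partial derivatives. -/
noncomputable def hessMat {n : ℕ} (ψ : En n → ℝ) (x : En n) : Matrix (Fin n) (Fin n) ℝ :=
  Matrix.of fun i j =>
    fderiv ℝ (fun y => fderiv ℝ ψ y (EuclideanSpace.single j 1)) x (EuclideanSpace.single i 1)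

/-- The exponent `b = 1 + 1/(1+p)`. -/
noncomputable def bexp (p : ℝ) : ℝ := 1 + 1 / (1 + p)

/-- `|x|_s = Σᵢ |xᵢ|^s`. -/
noncomputable def normS {n : ℕ} (s : ℝ) (x : En n) : ℝ := ∑ i, |x i| ^ s

/-- `x^s`, the vector with components `|xᵢ|^{s−1}·xᵢ`. -/
noncomputable def vpowS {n : ℕ} (s : ℝ) (x : En n) : Fin n → ℝ := fun i => |x i| ^ (s - 1) * x i

/-- The barrier function `Φ₀(x) = (1/(ab))·(Σᵢ |xᵢ|^b)^{−a}` with `b = 1 + 1/(1+p)`. -/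
noncomputable def Phi0 (n : ℕ) (p a : ℝ) (x : En n) : ℝ :=
  (1 / (a * bexp p)) * (∑ i, |x i| ^ bexp p) ^ (-a)

/-- `D_p(z) = diag(|z₁|^{p/2},…,|zₙ|^{p/2})`. -/
noncomputable def Dp {n : ℕ} (p : ℝ) (z : Fin n → ℝ) : Matrix (Fin n) (Fin n) ℝ :=
  Matrix.diagonal fun i => |z i| ^ (p / 2)

theorem bexp_pos {p : ℝ} (hp : 0 ≤ p) : 0 < bexp p := by
  unfold bexp; positivity

theorem bexp_mul {p : ℝ} (hp : 0 ≤ p) : (bexp p - 1) * (p + 1) = 1 := by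
  have : 1 + p ≠ 0 := by positivity
  unfold bexp; field_simp; ring

theorem hasDerivAt_abs_rpow_of_ne_zero (s : ℝ) {t : ℝ} (ht : t ≠ 0) :
    HasDerivAt (fun u : ℝ => |u| ^ s) (s * (|t| ^ (s - 2) * t)) t := by
  have h0 : 0 < |t| := abs_pos.mpr ht
  have h := (hasDerivAt_abs ht).rpow_const (p := s) (Or.inl h0.ne')
  convert h using 1
  have e : |t| ^ (s - 1) = |t| ^ (s - 2) * |t| := by
    rw [← Real.rpow_add_one h0.ne']; congr 1; ring
  rw [e]
  have hs : t = (SignType.sign t : ℝ) * |t| := (sign_mul_abs t).symm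
  calc s * (|t| ^ (s - 2) * t) = s * (|t| ^ (s - 2) * ((SignType.sign t : ℝ) * |t|)) := by
        rw [← hs]
    _ = _ := by ring

theorem hasDerivAt_abs_rpow_mul_self (r : ℝ) {t : ℝ} (ht : t ≠ 0) :
    HasDerivAt (fun u : ℝ => |u| ^ r * u) ((r + 1) * |t| ^ r) t := by
  have h0 : 0 < |t| := abs_pos.mpr ht
  refine ((hasDerivAt_abs_rpow_of_ne_zero r ht).mul (hasDerivAt_id t)).congr_deriv ?_
  have e : |t| ^ r = |t| ^ (r - 2) * t ^ 2 := by
    rw [← sq_abs, ← Real.rpow_natCast |t| 2, ← Real.rpow_add h0]; congr 1; push_cast; ring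
  rw [e]; dsimp only [id]; ring

theorem hasFDerivAt_coord {n : ℕ} (x : En n) (i : Fin n) :
    HasFDerivAt (fun y : En n => y i) (EuclideanSpace.proj i : En n →L[ℝ] ℝ) x :=
  (EuclideanSpace.proj i : En n →L[ℝ] ℝ).hasFDerivAt

theorem normS_pos {n : ℕ} (hn : 1 ≤ n) (s : ℝ) {x : En n} (hx : ∀ i, x i ≠ 0) :
    0 < normS s x :=
  Finset.sum_pos (fun i _ => Real.rpow_pos_of_pos (abs_pos.mpr (hx i)) s) ⟨⟨0, hn⟩, Finset.mem_univ _⟩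

theorem hasFDerivAt_normS {n : ℕ} (s : ℝ) {x : En n} (hx : ∀ i, x i ≠ 0) :
    HasFDerivAt (normS s)
      (∑ i, (s * (|x i| ^ (s - 2) * x i)) • (EuclideanSpace.proj i : En n →L[ℝ] ℝ)) x := by
  unfold normS
  refine HasFDerivAt.fun_sum fun i _ => ?_
  have h := (hasDerivAt_abs_rpow_of_ne_zero s (hx i)).comp_hasFDerivAt x (hasFDerivAt_coord x i)
  exact h

theorem hasFDerivAt_normS_rpow {n : ℕ} (hn : 1 ≤ n) (s c : ℝ) {x : En n} (hx : ∀ i, x i ≠ 0) :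
    HasFDerivAt (fun y => normS s y ^ c) ((c * normS s x ^ (c - 1)) •
      (∑ i, (s * (|x i| ^ (s - 2) * x i)) • (EuclideanSpace.proj i : En n →L[ℝ] ℝ))) x :=
  (hasFDerivAt_normS s hx).rpow_const (Or.inl (normS_pos hn s hx).ne')

theorem sum_smul_proj_single {n : ℕ} (f : Fin n → ℝ) (i : Fin n) :
    (∑ k, f k • (EuclideanSpace.proj k : En n →L[ℝ] ℝ)) (EuclideanSpace.single i 1) = f i := by
  simp

theorem gradVec_Phi0 {n : ℕ} (hn : 1 ≤ n) {p a : ℝ} (hp : 0 ≤ p) (ha : 0 < a)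
    {x : En n} (hx : ∀ i, x i ≠ 0) (i : Fin n) :
    gradVec (Phi0 n p a) x i
      = -(normS (bexp p) x ^ (-a - 1) * (|x i| ^ (bexp p - 2) * x i)) := by
  have hb := (bexp_pos hp).ne'
  have h : HasFDerivAt (Phi0 n p a) _ x :=
    (hasFDerivAt_normS_rpow hn (bexp p) (-a) hx).const_mul (1 / (a * bexp p))
  rw [gradVec, h.fderiv]
  simp only [smul_apply, sum_smul_proj_single, smul_eq_mul]
  field_simp

theorem eventually_coord_ne_zero {n : ℕ} {x : En n} (hx : ∀ i, x i ≠ 0) :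
    ∀ᶠ y in nhds x, ∀ i, y i ≠ 0 :=
  Filter.eventually_all.mpr fun i =>
    (hasFDerivAt_coord x i).continuousAt.eventually_ne (hx i)

theorem hessMat_Phi0 {n : ℕ} (hn : 1 ≤ n) {p a : ℝ} (hp : 0 ≤ p) (ha : 0 < a)
    {x : En n} (hx : ∀ i, x i ≠ 0) (i j : Fin n) :
    hessMat (Phi0 n p a) x i j
      = bexp p * (a + 1) * normS (bexp p) x ^ (-a - 2) * (|x i| ^ (bexp p - 2) * x i)
          * (|x j| ^ (bexp p - 2) * x j)
        - (bexp p - 1) * normS (bexp p) x ^ (-a - 1)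
          * (|x i| ^ (bexp p - 2) * (1 : Matrix (Fin n) (Fin n) ℝ) i j) := by
  have hev : (fun y => fderiv ℝ (Phi0 n p a) y (EuclideanSpace.single j 1)) =ᶠ[nhds x]
      fun y => -(normS (bexp p) y ^ (-a - 1) * (|y j| ^ (bexp p - 2) * y j)) :=
    (eventually_coord_ne_zero hx).mono fun y hy => gradVec_Phi0 hn hp ha hy j
  have h := ((hasFDerivAt_normS_rpow hn (bexp p) (-a - 1) hx).mul
    ((hasDerivAt_abs_rpow_mul_self (bexp p - 2) (hx j)).comp_hasFDerivAt x
      (hasFDerivAt_coord x j))).neg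
  have h' : HasFDerivAt
      (fun y : En n => -(normS (bexp p) y ^ (-a - 1) * (|y j| ^ (bexp p - 2) * y j))) _ x := h
  rw [hessMat, Matrix.of_apply, hev.fderiv_eq, h'.fderiv]
  simp only [neg_apply, add_apply,
    smul_apply, sum_smul_proj_single, smul_eq_mul, Function.comp]
  rw [show -a - 1 - 1 = -a - 2 by ring]
  rcases eq_or_ne i j with rfl | hij
  · simp; ring
  · simp [Matrix.one_apply_ne hij, hij.symm]; ring

theorem abs_gradVec_Phi0_rpow {n : ℕ} (hn : 1 ≤ n) {p a : ℝ} (hp : 0 ≤ p) (ha : 0 < a)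
    {x : En n} (hx : ∀ i, x i ≠ 0) (i : Fin n) (c : ℝ) :
    |gradVec (Phi0 n p a) x i| ^ c
      = normS (bexp p) x ^ ((-a - 1) * c) * |x i| ^ ((bexp p - 1) * c) := by
  have hS := normS_pos hn (bexp p) hx
  have h0 : 0 < |x i| := abs_pos.mpr (hx i)
  rw [gradVec_Phi0 hn hp ha hx, abs_neg, abs_mul, abs_mul,
    abs_of_pos (Real.rpow_pos_of_pos hS _), abs_of_pos (Real.rpow_pos_of_pos h0 _),
    ← Real.rpow_add_one h0.ne', Real.mul_rpow (by positivity) (by positivity),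
    ← Real.rpow_mul hS.le, ← Real.rpow_mul h0.le]
  ring_nf

theorem vpowS_half_sq {n : ℕ} (s : ℝ) {x : En n} (hx : ∀ i, x i ≠ 0) (i : Fin n) :
    vpowS (s / 2) x i ^ 2 = |x i| ^ s := by
  have h0 : 0 < |x i| := abs_pos.mpr (hx i)
  rw [vpowS, mul_pow, ← sq_abs (x i), ← mul_pow, ← Real.rpow_add_one h0.ne',
    ← Real.rpow_natCast, ← Real.rpow_mul h0.le]
  congr 1; push_cast; ring

/-- The conjugated Hessian of the barrier `Φ₀`: with `v = x^{b/2}/|x|_b^{1/2}`, one has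
`|v| = 1` and
`D_p(DΦ₀)·D²Φ₀·D_p(DΦ₀)(x) = |x|_b^{−(a+1)(p+1)}·(b(a+1)(v ⊗ v) − (b−1)Iₙ)`. -/
theorem Phi0_conjugated_hessian (n : ℕ) (hn : 1 ≤ n) (p a : ℝ) (hp : 0 ≤ p) (ha : 0 < a)
    (x : En n) (hx : ∀ i, x i ≠ 0) :
    Real.sqrt (∑ i, (vpowS (bexp p / 2) x i / normS (bexp p) x ^ ((1:ℝ) / 2)) ^ 2) = 1 ∧
    Dp p (gradVec (Phi0 n p a) x) * hessMat (Phi0 n p a) x * Dp p (gradVec (Phi0 n p a) x)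
      = normS (bexp p) x ^ (-((a + 1) * (p + 1))) •
          ((bexp p * (a + 1)) •
              Matrix.vecMulVec
                (fun i => vpowS (bexp p / 2) x i / normS (bexp p) x ^ ((1:ℝ) / 2))
                (fun i => vpowS (bexp p / 2) x i / normS (bexp p) x ^ ((1:ℝ) / 2))
            - (bexp p - 1) • (1 : Matrix (Fin n) (Fin n) ℝ)) := by
  have hS := normS_pos hn (bexp p) hx
  have hb := bexp_mul hp
  constructor
  · have hsq : (normS (bexp p) x ^ ((1:ℝ) / 2)) ^ 2 = normS (bexp p) x := by
      rw [← Real.sqrt_eq_rpow, Real.sq_sqrt hS.le]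
    simp only [div_pow, hsq, vpowS_half_sq _ hx]
    rw [← Finset.sum_div, ← normS, div_self hS.ne', Real.sqrt_one]
  · ext i j
    have h0 : ∀ k, 0 < |x k| := fun k => abs_pos.mpr (hx k)
    have hcomb : ∀ k, |x k| ^ ((bexp p - 1) * (p / 2)) * |x k| ^ (bexp p - 2)
        = |x k| ^ (bexp p / 2 - 1) := fun k => by
      rw [← Real.rpow_add (h0 k)]; congr 1; linear_combination hb / 2
    have hdiag : ∀ k, |x k| ^ ((bexp p - 1) * (p / 2)) * |x k| ^ ((bexp p - 1) * (p / 2))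
        * |x k| ^ (bexp p - 2) = 1 := fun k => by
      rw [← Real.rpow_add (h0 k), ← Real.rpow_add (h0 k)]
      convert Real.rpow_zero |x k| using 2
      linear_combination hb
    rw [Dp, Matrix.mul_diagonal, Matrix.diagonal_mul, hessMat_Phi0 hn hp ha hx,
      abs_gradVec_Phi0_rpow hn hp ha hx, abs_gradVec_Phi0_rpow hn hp ha hx]
    simp only [Matrix.smul_apply, Matrix.sub_apply, Matrix.vecMulVec_apply, smul_eq_mul, vpowS]
    rw [div_mul_div_comm, ← Real.rpow_add hS, add_halves, Real.rpow_one]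
    generalize hSd : normS (bexp p) x = S at hS ⊢
    have hS1 : S ^ ((-a - 1) * (p / 2)) * S ^ ((-a - 1) * (p / 2)) * S ^ (-a - 1)
        = S ^ (-((a + 1) * (p + 1))) := by
      rw [← Real.rpow_add hS, ← Real.rpow_add hS]; congr 1; ring
    have hS2 : S ^ (-a - 2) = S ^ (-a - 1) / S := by
      rw [← Real.rpow_sub_one hS.ne']; congr 1; ring
    rw [hS2, ← hS1, ← hcomb i, ← hcomb j]
    rcases eq_or_ne i j with rfl | hij
    · rw [Matrix.one_apply_eq]
      linear_combination (-(bexp p - 1) * (S ^ ((-a - 1) * (p / 2)) * S ^ ((-a - 1) * (p / 2))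
        * S ^ (-a - 1))) * hdiag i
    · rw [Matrix.one_apply_ne hij]
      ring
end
end

section
/- Define g : {x ∈ ℝⁿ : x ≠ 0} → ℝⁿ by g(y) = −K·|y|_b^{−(a+1)}·y^{b−1} (the gradient of K·Φ₀), and define h : {x ∈ ℝⁿ : x ≠ 0} → ℝⁿ by h(x) = −K^{1/(ab+1)}·|x|_{2+p}^{−(a+1)/(ab+1)}·x^{1+p}. Then for every y ∈ ℝⁿ with y ≠ 0, h(g(y)) = y; that is, h is a left inverse of the gradient map g. -/
noncomputable section

/-- The gradient map `g(y) = −K·|y|_b^{−(a+1)}·y^{b−1}` of `K·Φ₀`, componentwise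
`g(y)ᵢ = −K·(Σⱼ |yⱼ|^b)^{−(a+1)}·|yᵢ|^{b−2}·yᵢ`. -/
noncomputable def gmap (n : ℕ) (p a K : ℝ) (y : Fin n → ℝ) : Fin n → ℝ :=
  fun i => -K * (∑ j, |y j| ^ bexp p) ^ (-(a + 1)) * (|y i| ^ (bexp p - 2) * y i)

/-- The map `h(x) = −K^{1/(ab+1)}·|x|_{2+p}^{−(a+1)/(ab+1)}·x^{1+p}`, componentwise
`h(x)ᵢ = −K^{1/(ab+1)}·(Σⱼ |xⱼ|^{2+p})^{−(a+1)/(ab+1)}·|xᵢ|^p·xᵢ`. -/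
noncomputable def hmap (n : ℕ) (p a K : ℝ) (x : Fin n → ℝ) : Fin n → ℝ :=
  fun i => -K ^ (1 / (a * bexp p + 1)) *
    (∑ j, |x j| ^ (2 + p)) ^ (-((a + 1) / (a * bexp p + 1))) * (|x i| ^ p * x i)

/-- Taking absolute values in the signed power `|t|^(b-2) t` gives `|t|^(b-1) = |t|^(1/(1+p))`. -/
lemma abs_signed_rpow {p : ℝ} (hp : 0 ≤ p) (t : ℝ) :
    |(|t| ^ (bexp p - 2) * t)| = |t| ^ (1 / (1 + p)) := by
  rcases eq_or_ne t 0 with rfl | ht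
  · have : 1 / (1 + p) ≠ 0 := by positivity
    simp only [mul_zero, abs_zero]
    rw [Real.zero_rpow this]
  · have ht' : 0 < |t| := abs_pos.mpr ht
    rw [abs_mul, abs_of_pos (Real.rpow_pos_of_pos ht' _), ← Real.rpow_add_one ht'.ne']
    congr 1
    unfold bexp
    ring

/-- The signed powers with exponents `1 + p` and `b - 1` are inverse to each other. -/
lemma signed_rpow_signed_rpow {p : ℝ} (hp : 0 ≤ p) (t : ℝ) :
    (|t| ^ (1 / (1 + p))) ^ p * (|t| ^ (bexp p - 2) * t) = t := by
  rcases eq_or_ne t 0 with rfl | ht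
  · simp
  · have ht' : 0 < |t| := abs_pos.mpr ht
    have hp1 : 1 + p ≠ 0 := by positivity
    rw [← Real.rpow_mul ht'.le, ← mul_assoc, ← Real.rpow_add ht']
    have : 1 / (1 + p) * p + (bexp p - 2) = 0 := by
      unfold bexp
      field_simp
      ring
    rw [this, Real.rpow_zero, one_mul]

/-- The scalar factors in `h(g(y))` cancel, where `S` stands for `|y|_b`. -/
lemma scalar_factor_eq_one {p a K S : ℝ} (hp : 0 ≤ p) (ha : 0 < a) (hK : 0 < K) (hS : 0 < S) :
    K ^ (1 / (a * bexp p + 1)) *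
      ((K * S ^ (-(a + 1))) ^ (2 + p) * S) ^ (-((a + 1) / (a * bexp p + 1))) *
      (K * S ^ (-(a + 1))) ^ (1 + p) = 1 := by
  have hp1 : 1 + p ≠ 0 := by positivity
  have hb : 0 < bexp p := by unfold bexp; positivity
  have hD : a * bexp p + 1 ≠ 0 := by positivity
  have hbp : bexp p * (1 + p) = 2 + p := by
    unfold bexp
    field_simp
    ring
  apply Real.eq_one_of_pos_of_log_eq_zero (by positivity)
  have hc : 0 < K * S ^ (-(a + 1)) := by positivity
  rw [Real.log_mul (by positivity) (by positivity), Real.log_mul (by positivity) (by positivity),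
    Real.log_rpow hK, Real.log_rpow (by positivity), Real.log_rpow hc,
    Real.log_mul (by positivity) hS.ne', Real.log_rpow hc,
    Real.log_mul hK.ne' (by positivity), Real.log_rpow hS, ← hbp]
  field_simp
  linear_combination (-(Real.log K - (a + 1) * Real.log S)) * hbp

/-- `h` is a left inverse of the gradient map `g`: `h(g(y)) = y` for every `y ≠ 0`. -/
theorem hmap_gmap (n : ℕ) (hn : 1 ≤ n) (p a K : ℝ) (hp : 0 ≤ p) (ha : 0 < a) (hK : 0 < K) :
    ∀ y : Fin n → ℝ, y ≠ 0 → hmap n p a K (gmap n p a K y) = y := by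
  intro y hy
  obtain ⟨k, hk⟩ := Function.ne_iff.mp hy
  have hp1 : 1 + p ≠ 0 := by positivity
  set S := ∑ j, |y j| ^ bexp p with hSdef
  have hS : 0 < S :=
    Finset.sum_pos' (fun j _ => Real.rpow_nonneg (abs_nonneg _) _)
      ⟨k, Finset.mem_univ k, Real.rpow_pos_of_pos (abs_pos.mpr hk) _⟩
  set c := K * S ^ (-(a + 1)) with hcdef
  have hc : 0 < c := by positivity
  have hg (i : Fin n) : gmap n p a K y i = -(c * (|y i| ^ (bexp p - 2) * y i)) := by
    simp only [gmap, hcdef, hSdef]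
    ring
  have habs (i : Fin n) : |gmap n p a K y i| = c * |y i| ^ (1 / (1 + p)) := by
    rw [hg, abs_neg, abs_mul, abs_of_pos hc, abs_signed_rpow hp]
  have hsum : ∑ j, |gmap n p a K y j| ^ (2 + p) = c ^ (2 + p) * S := by
    rw [hSdef, Finset.mul_sum]
    refine Finset.sum_congr rfl fun j _ => ?_
    rw [habs, Real.mul_rpow hc.le (by positivity), ← Real.rpow_mul (abs_nonneg _)]
    congr 2
    unfold bexp
    field_simp
    ring
  funext i
  have hpow : |gmap n p a K y i| ^ p * gmap n p a K y i = -(c ^ (1 + p) * y i) := by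
    rw [habs, hg, Real.mul_rpow hc.le (by positivity), Real.rpow_add hc, Real.rpow_one]
    linear_combination (-(c * c ^ p)) * signed_rpow_signed_rpow hp (y i)
  have hscalar := scalar_factor_eq_one hp ha hK hS
  rw [← hcdef] at hscalar
  unfold hmap
  rw [hsum, hpow]
  linear_combination y i * hscalar
end
end
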